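/- Let F ∈ ℝ, a > 0, b > 0, E > 0, 0 < ν < 1/2, I = 4ab³/3, μ = E/(2(1+ν)), and let (u_x, u_y, u_z) be the cantilever beam displacement field. Then at every interior point of the beam (−a,a) × (−b,b) × ℝ, the shear stresses computed from the displacement via Hooke's law equal the series expressions of the analytical stress field: 2μ·ε_xz(u) = μ(∂u_x/∂z + ∂u_z/∂x) = (F/I)·(2a²/π²)·(ν/(1+ν))·Σ_{n=1}^{∞} ((−1)^n/n²)·sin(nπx/a)·sinh(nπy/a)/cosh(nπb/a), and 2μ·ε_yz(u) = μ(∂u_y/∂z + ∂u_z/∂y) = (F/I)·(b² − y²)/2 + (F/I)·(ν/(1+ν))·[(3x² − a²)/6 − (2a²/π²)·Σ_{n=1}^{∞} ((−1)^n/n²)·cos(nπx/a)·cosh(nπy/a)/cosh(nπb/a)]. In particular the series defining u_z may be differentiated term by term in x and in y on the open beam. -/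

import Mathlib

open Real

/-- Cantilever beam displacement component `u_x`; `II = 4ab³/3`. -/
noncomputable def beamUx (F E ν II : ℝ) (x y z : ℝ) : ℝ :=
  -(F * ν / (E * II)) * x * y * z

/-- Cantilever beam displacement component `u_y`. -/
noncomputable def beamUy (F E ν II : ℝ) (x y z : ℝ) : ℝ :=
  F / (E * II) * (ν / 2 * (x ^ 2 - y ^ 2) * z - z ^ 3 / 6)

/-- Cantilever beam displacement component `u_z` (series solution). -/
noncomputable def beamUz (F E ν II a b : ℝ) (x y z : ℝ) : ℝ :=
  F / (E * II) *
    (1 / 2 * y * (ν * x ^ 2 + z ^ 2) + 1 / 6 * ν * y ^ 3 +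
      (1 + ν) * (b ^ 2 * y - 1 / 3 * y ^ 3) - 1 / 3 * a ^ 2 * ν * y -
      4 * a ^ 3 * ν / π ^ 3 *
        ∑' m : ℕ, ((-1 : ℝ) ^ (m + 1) / ((m : ℝ) + 1) ^ 3) *
          Real.cos (((m : ℝ) + 1) * π * x / a) *
          Real.sinh (((m : ℝ) + 1) * π * y / a) / Real.cosh (((m : ℝ) + 1) * π * b / a))

/-- Cantilever beam shear stress `σ_xz` (series solution). -/
noncomputable def beamSxz (F II a b ν x y : ℝ) : ℝ :=
  F / II * (2 * a ^ 2 / π ^ 2) * (ν / (1 + ν)) *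
    ∑' m : ℕ, ((-1 : ℝ) ^ (m + 1) / ((m : ℝ) + 1) ^ 2) *
      Real.sin (((m : ℝ) + 1) * π * x / a) *
      Real.sinh (((m : ℝ) + 1) * π * y / a) / Real.cosh (((m : ℝ) + 1) * π * b / a)

/-- Cantilever beam shear stress `σ_yz` (series solution). -/
noncomputable def beamSyz (F II a b ν x y : ℝ) : ℝ :=
  F / II * ((b ^ 2 - y ^ 2) / 2) +
    F / II * (ν / (1 + ν)) *
      ((3 * x ^ 2 - a ^ 2) / 6 -
        (2 * a ^ 2 / π ^ 2) *
          ∑' m : ℕ, ((-1 : ℝ) ^ (m + 1) / ((m : ℝ) + 1) ^ 2) *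
            Real.cos (((m : ℝ) + 1) * π * x / a) *
            Real.cosh (((m : ℝ) + 1) * π * y / a) / Real.cosh (((m : ℝ) + 1) * π * b / a))

theorem abs_series_term_le (p m : ℕ) (hp : 2 ≤ p) {c h d : ℝ} (hc : |c| ≤ 1)
    (hd : 0 < d) (hh : |h| ≤ d) :
    ‖(-1 : ℝ) ^ (m + 1) / ((m : ℝ) + 1) ^ p * c * h / d‖ ≤ 1 / ((m : ℝ) + 1) ^ 2 := by
  have hm : (1 : ℝ) ≤ (m : ℝ) + 1 := by linarith [(Nat.cast_nonneg m : (0 : ℝ) ≤ m)]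
  have hq : |h| / d ≤ 1 := (div_le_one hd).2 hh
  rw [Real.norm_eq_abs, mul_div_assoc, abs_mul, abs_mul, abs_div, abs_div, abs_pow, abs_neg,
    abs_one, one_pow, abs_pow, abs_of_pos (by linarith : (0 : ℝ) < (m : ℝ) + 1), abs_of_pos hd]
  calc 1 / ((m : ℝ) + 1) ^ p * |c| * (|h| / d) ≤ 1 / ((m : ℝ) + 1) ^ p * 1 * 1 := by gcongr
    _ ≤ 1 / ((m : ℝ) + 1) ^ 2 := by
      rw [mul_one, mul_one]
      gcongr

theorem summable_one_div_add_one_sq : Summable fun m : ℕ => 1 / ((m : ℝ) + 1) ^ 2 := by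
  have h := (summable_nat_add_iff 1).2 (Real.summable_one_div_nat_pow.2 (by norm_num : 1 < 2))
  simpa using h

theorem cosh_mode_le {a b y : ℝ} (hy : |y| ≤ b) (m : ℕ) :
    Real.cosh (((m : ℝ) + 1) * π * y / a) ≤ Real.cosh (((m : ℝ) + 1) * π * b / a) := by
  rw [Real.cosh_le_cosh, abs_div, abs_div, abs_mul, abs_mul _ b]
  exact div_le_div_of_nonneg_right (mul_le_mul_of_nonneg_left
    (hy.trans (le_abs_self b)) (abs_nonneg _)) (abs_nonneg _)

theorem abs_sinh_le_cosh (t : ℝ) : |Real.sinh t| ≤ Real.cosh t := by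
  rw [← Real.cosh_abs, Real.abs_sinh]
  exact (Real.sinh_lt_cosh _).le

theorem summable_warping_series {a b y : ℝ} (hy : |y| ≤ b) (x : ℝ) :
    Summable fun m : ℕ => ((-1 : ℝ) ^ (m + 1) / ((m : ℝ) + 1) ^ 3) *
      Real.cos (((m : ℝ) + 1) * π * x / a) *
      Real.sinh (((m : ℝ) + 1) * π * y / a) / Real.cosh (((m : ℝ) + 1) * π * b / a) :=
  summable_one_div_add_one_sq.of_norm_bounded fun m =>
    abs_series_term_le 3 m (by norm_num) (Real.abs_cos_le_one _) (Real.cosh_pos _)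
      ((abs_sinh_le_cosh _).trans (cosh_mode_le hy m))

/-- Termwise differentiation in `x` of the series in `u_z`. -/
theorem hasDerivAt_warping_series_x {a b y : ℝ} (ha : 0 < a) (hy : |y| ≤ b) (x : ℝ) :
    HasDerivAt (fun s => ∑' m : ℕ, ((-1 : ℝ) ^ (m + 1) / ((m : ℝ) + 1) ^ 3) *
      Real.cos (((m : ℝ) + 1) * π * s / a) *
      Real.sinh (((m : ℝ) + 1) * π * y / a) / Real.cosh (((m : ℝ) + 1) * π * b / a))
      (-(π / a) * ∑' m : ℕ, ((-1 : ℝ) ^ (m + 1) / ((m : ℝ) + 1) ^ 2) *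
      Real.sin (((m : ℝ) + 1) * π * x / a) *
      Real.sinh (((m : ℝ) + 1) * π * y / a) / Real.cosh (((m : ℝ) + 1) * π * b / a)) x := by
  rw [← tsum_mul_left]
  refine hasDerivAt_tsum
    (g := fun (m : ℕ) (s : ℝ) => ((-1 : ℝ) ^ (m + 1) / ((m : ℝ) + 1) ^ 3) *
      Real.cos (((m : ℝ) + 1) * π * s / a) *
      Real.sinh (((m : ℝ) + 1) * π * y / a) / Real.cosh (((m : ℝ) + 1) * π * b / a))
    (g' := fun (m : ℕ) (s : ℝ) => -(π / a) * (((-1 : ℝ) ^ (m + 1) / ((m : ℝ) + 1) ^ 2) *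
      Real.sin (((m : ℝ) + 1) * π * s / a) *
      Real.sinh (((m : ℝ) + 1) * π * y / a) / Real.cosh (((m : ℝ) + 1) * π * b / a)))
    (summable_one_div_add_one_sq.mul_left (π / a))
    (fun m s => ?_) (fun m s => ?_) (y₀ := x) ?_ x
  · have hlin : HasDerivAt (fun s : ℝ => ((m : ℝ) + 1) * π * s / a)
        (((m : ℝ) + 1) * π * 1 / a) s := ((hasDerivAt_id s).const_mul _).div_const a
    refine HasDerivAt.congr_deriv
      (((hlin.cos.const_mul ((-1 : ℝ) ^ (m + 1) / ((m : ℝ) + 1) ^ 3)).mul_const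
      (Real.sinh (((m : ℝ) + 1) * π * y / a))).div_const
      (Real.cosh (((m : ℝ) + 1) * π * b / a))) ?_
    field_simp
  · rw [norm_mul, norm_neg, Real.norm_of_nonneg (by positivity : 0 ≤ π / a)]
    gcongr
    exact abs_series_term_le 2 m le_rfl (Real.abs_sin_le_one _) (Real.cosh_pos _)
      ((abs_sinh_le_cosh _).trans (cosh_mode_le hy m))
  · exact summable_warping_series hy x

/-- Termwise differentiation in `y` of the series in `u_z`. -/
theorem hasDerivAt_warping_series_y {a b y : ℝ} (ha : 0 < a) (hy : |y| < b) (x : ℝ) :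
    HasDerivAt (fun t => ∑' m : ℕ, ((-1 : ℝ) ^ (m + 1) / ((m : ℝ) + 1) ^ 3) *
      Real.cos (((m : ℝ) + 1) * π * x / a) *
      Real.sinh (((m : ℝ) + 1) * π * t / a) / Real.cosh (((m : ℝ) + 1) * π * b / a))
      (π / a * ∑' m : ℕ, ((-1 : ℝ) ^ (m + 1) / ((m : ℝ) + 1) ^ 2) *
      Real.cos (((m : ℝ) + 1) * π * x / a) *
      Real.cosh (((m : ℝ) + 1) * π * y / a) / Real.cosh (((m : ℝ) + 1) * π * b / a)) y := by
  rw [← tsum_mul_left]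
  refine hasDerivAt_tsum_of_isPreconnected (t := Set.Ioo (-b) b)
    (g := fun (m : ℕ) (t : ℝ) => ((-1 : ℝ) ^ (m + 1) / ((m : ℝ) + 1) ^ 3) *
      Real.cos (((m : ℝ) + 1) * π * x / a) *
      Real.sinh (((m : ℝ) + 1) * π * t / a) / Real.cosh (((m : ℝ) + 1) * π * b / a))
    (g' := fun (m : ℕ) (t : ℝ) => π / a * (((-1 : ℝ) ^ (m + 1) / ((m : ℝ) + 1) ^ 2) *
      Real.cos (((m : ℝ) + 1) * π * x / a) *
      Real.cosh (((m : ℝ) + 1) * π * t / a) / Real.cosh (((m : ℝ) + 1) * π * b / a)))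
    (summable_one_div_add_one_sq.mul_left (π / a)) isOpen_Ioo isPreconnected_Ioo
    (fun m t _ => ?_) (fun m t ht => ?_) (abs_lt.1 hy)
    ?_ (abs_lt.1 hy)
  · have hlin : HasDerivAt (fun t : ℝ => ((m : ℝ) + 1) * π * t / a)
        (((m : ℝ) + 1) * π * 1 / a) t := ((hasDerivAt_id t).const_mul _).div_const a
    refine HasDerivAt.congr_deriv ((hlin.sinh.const_mul ((-1 : ℝ) ^ (m + 1) / ((m : ℝ) + 1) ^ 3 *
      Real.cos (((m : ℝ) + 1) * π * x / a))).div_const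
      (Real.cosh (((m : ℝ) + 1) * π * b / a))) ?_
    field_simp
  · rw [norm_mul, Real.norm_of_nonneg (by positivity : 0 ≤ π / a)]
    gcongr
    refine abs_series_term_le 2 m le_rfl (Real.abs_cos_le_one _) (Real.cosh_pos _) ?_
    rw [abs_of_pos (Real.cosh_pos _)]
    exact cosh_mode_le (abs_lt.2 ht).le m
  · exact summable_warping_series hy.le x

/-- **Shear stresses of the cantilever beam displacement field via Hooke's law
agree with the analytical series stress field:** at every interior point,
`μ(∂u_x/∂z + ∂u_z/∂x) = σ_xz` and `μ(∂u_y/∂z + ∂u_z/∂y) = σ_yz`; in particular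
the series defining `u_z` may be differentiated term by term in `x` and in `y`
(the partial derivatives of `u_z` exist on the open beam). -/
theorem beam_displacement_shear_stresses
    (F a b E ν II μ : ℝ) (ha : 0 < a) (hb : 0 < b) (hE : 0 < E)
    (hν₁ : 0 < ν) (hν₂ : ν < 1 / 2) (hII : II = 4 * a * b ^ 3 / 3)
    (hμ : μ = E / (2 * (1 + ν)))
    (x y z : ℝ) (hx : x ∈ Set.Ioo (-a) a) (hy : y ∈ Set.Ioo (-b) b) :
    DifferentiableAt ℝ (fun s => beamUz F E ν II a b s y z) x ∧
    DifferentiableAt ℝ (fun t => beamUz F E ν II a b x t z) y ∧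
    μ * (deriv (fun u => beamUx F E ν II x y u) z +
        deriv (fun s => beamUz F E ν II a b s y z) x) = beamSxz F II a b ν x y ∧
    μ * (deriv (fun u => beamUy F E ν II x y u) z +
        deriv (fun t => beamUz F E ν II a b x t z) y) = beamSyz F II a b ν x y := by
  have hyb : |y| < b := abs_lt.2 hy
  have hI : II ≠ 0 := by rw [hII]; positivity
  have hν : 1 + ν ≠ 0 := by linarith
  have hUx : HasDerivAt (fun u => beamUx F E ν II x y u) (-(F * ν / (E * II)) * x * y * 1) z :=
    (hasDerivAt_id z).const_mul _
  have hUy : HasDerivAt (fun u => beamUy F E ν II x y u)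
      (F / (E * II) * (ν / 2 * (x ^ 2 - y ^ 2) - z ^ 2 / 2)) z := by
    refine HasDerivAt.const_mul (F / (E * II)) ?_
    refine HasDerivAt.congr_deriv (((hasDerivAt_id z).const_mul (ν / 2 * (x ^ 2 - y ^ 2))).sub
      ((hasDerivAt_pow 3 z).div_const 6)) ?_
    norm_num
    ring
  have hUzx := HasDerivAt.const_mul (F / (E * II))
    ((((((((((hasDerivAt_pow 2 x).const_mul ν).add_const (z ^ 2)).const_mul (1 / 2 * y)).add_const
      (1 / 6 * ν * y ^ 3)).add_const ((1 + ν) * (b ^ 2 * y - 1 / 3 * y ^ 3))).sub_const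
      (1 / 3 * a ^ 2 * ν * y))).sub
      ((hasDerivAt_warping_series_x ha hyb.le x).const_mul (4 * a ^ 3 * ν / π ^ 3))))
  have hUzy := HasDerivAt.const_mul (F / (E * II))
    ((((((((hasDerivAt_id y).const_mul (1 / 2)).mul_const (ν * x ^ 2 + z ^ 2)).add
      ((hasDerivAt_pow 3 y).const_mul (1 / 6 * ν))).add
      ((((hasDerivAt_id y).const_mul (b ^ 2)).sub
        ((hasDerivAt_pow 3 y).const_mul (1 / 3))).const_mul (1 + ν))).sub
      ((hasDerivAt_id y).const_mul (1 / 3 * a ^ 2 * ν))).sub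
      ((hasDerivAt_warping_series_y ha hyb x).const_mul (4 * a ^ 3 * ν / π ^ 3))))
  change HasDerivAt (fun s => beamUz F E ν II a b s y z) _ x at hUzx
  change HasDerivAt (fun t => beamUz F E ν II a b x t z) _ y at hUzy
  refine ⟨hUzx.differentiableAt, hUzy.differentiableAt, ?_, ?_⟩
  · rw [hUx.deriv, hUzx.deriv, hμ, beamSxz]
    generalize (∑' m : ℕ, _ : ℝ) = S
    push_cast
    field_simp
    ring
  · rw [hUy.deriv, hUzy.deriv, hμ, beamSyz]
    generalize (∑' m : ℕ, _ : ℝ) = S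
    push_cast
    field_simp
    ring
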